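/- For every r ≡ 0 or 2 (mod 3), if b ∈ J'³(2r) and a₁, a₂, a₃ ∈ J³_F(r+1), then a₁ + a₂ + a₃ + b ∈ J³_F(3r+1). -/

import Mathlib

/-- A Steiner triple system of order `v`: a collection of 3-element subsets of a
`v`-point set such that every 2-element subset lies in exactly one triple. -/
def IsSTS (v : ℕ) (B : Finset (Finset (Fin v))) : Prop :=
  (∀ b ∈ B, b.card = 3) ∧
  ∀ p : Finset (Fin v), p.card = 2 → ∃! b, b ∈ B ∧ p ⊆ b

/-- The flower at a point `x`: the set of all triples containing `x`. -/
def flowerAt {v : ℕ} (B : Finset (Finset (Fin v))) (x : Fin v) : Finset (Finset (Fin v)) :=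
  B.filter fun b => x ∈ b

/-- `J3F r`: the set of all `k` for which there exist three `STS(2r+1)`'s on a common
point set such that each pair of them intersects in the same set of `k + r` triples,
`r` of which form the flower at a common point. -/
def J3F (r : ℕ) : Set ℕ :=
  {k | ∃ (B₁ B₂ B₃ : Finset (Finset (Fin (2 * r + 1)))) (x : Fin (2 * r + 1)),
    IsSTS (2 * r + 1) B₁ ∧ IsSTS (2 * r + 1) B₂ ∧ IsSTS (2 * r + 1) B₃ ∧
    B₁ ∩ B₂ = B₁ ∩ B₃ ∧ B₁ ∩ B₂ = B₂ ∩ B₃ ∧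
    (B₁ ∩ B₂).card = k + r ∧
    flowerAt B₁ x = flowerAt B₂ x ∧ flowerAt B₁ x = flowerAt B₃ x ∧
    (flowerAt B₁ x).card = r}

/-- `J3 v`: the set of all `k` for which there exist three `STS(v)`'s on a common point
set pairwise intersecting in the same set of `k` triples. -/
def J3 (v : ℕ) : Set ℕ :=
  {k | ∃ (B₁ B₂ B₃ : Finset (Finset (Fin v))),
    IsSTS v B₁ ∧ IsSTS v B₂ ∧ IsSTS v B₃ ∧
    B₁ ∩ B₂ = B₁ ∩ B₃ ∧ B₁ ∩ B₂ = B₂ ∩ B₃ ∧ (B₁ ∩ B₂).card = k}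

/-- `JF r`: the set of all `k` for which there exist two `STS(2r+1)`'s on a common
point set having exactly `k + r` triples in common, `r` of them forming a common flower. -/
def JF (r : ℕ) : Set ℕ :=
  {k | ∃ (B₁ B₂ : Finset (Finset (Fin (2 * r + 1)))) (x : Fin (2 * r + 1)),
    IsSTS (2 * r + 1) B₁ ∧ IsSTS (2 * r + 1) B₂ ∧
    (B₁ ∩ B₂).card = k + r ∧
    flowerAt B₁ x = flowerAt B₂ x ∧ (flowerAt B₁ x).card = r}

/-- `S3 m`: the nonnegative integers at most `m`, with the exception of
`m-1, m-2, m-3, m-4, m-5, m-7`. -/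
def S3 (m : ℕ) : Set ℕ :=
  {k | k ≤ m ∧ k + 1 ≠ m ∧ k + 2 ≠ m ∧ k + 3 ≠ m ∧ k + 4 ≠ m ∧ k + 5 ≠ m ∧ k + 7 ≠ m}

/-- `I3F r = S3 (2r(r-1)/3)`. -/
def I3F (r : ℕ) : Set ℕ := S3 (2 * r * (r - 1) / 3)

/-- A Latin square of order `n` as a function: each row and each column is injective
(hence a permutation of the `n` symbols). -/
def IsLatin (n : ℕ) (L : Fin n → Fin n → Fin n) : Prop :=
  (∀ i, Function.Injective (L i)) ∧ (∀ j, Function.Injective fun i => L i j)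

/-- The cells where three squares all have identical entries. -/
def agreeCells (n : ℕ) (L₁ L₂ L₃ : Fin n → Fin n → Fin n) : Finset (Fin n × Fin n) :=
  Finset.univ.filter fun p => L₁ p.1 p.2 = L₂ p.1 p.2 ∧ L₂ p.1 p.2 = L₃ p.1 p.2

/-- `J3L n` (written `J'³(n)`): the set of `k` for which there exist three Latin squares
of order `n` with exactly `k` cells where all three have identical entries and all other
cells containing pairwise distinct entries in the three squares. -/
def J3L (n : ℕ) : Set ℕ :=
  {k | ∃ L₁ L₂ L₃ : Fin n → Fin n → Fin n,
    IsLatin n L₁ ∧ IsLatin n L₂ ∧ IsLatin n L₃ ∧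
    (agreeCells n L₁ L₂ L₃).card = k ∧
    ∀ p : Fin n × Fin n, p ∉ agreeCells n L₁ L₂ L₃ →
      L₁ p.1 p.2 ≠ L₂ p.1 p.2 ∧ L₁ p.1 p.2 ≠ L₃ p.1 p.2 ∧ L₂ p.1 p.2 ≠ L₃ p.1 p.2}

/-- `J3LD n` (written `J''³(n)`): as `J3L n`, but additionally the three Latin squares
share the same constant value on the secondary diagonal (cells `(i, n-1-i)`). -/
def J3LD (n : ℕ) : Set ℕ :=
  {k | ∃ L₁ L₂ L₃ : Fin n → Fin n → Fin n,
    IsLatin n L₁ ∧ IsLatin n L₂ ∧ IsLatin n L₃ ∧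
    (∃ c, ∀ i : Fin n, L₁ i i.rev = c ∧ L₂ i i.rev = c ∧ L₃ i i.rev = c) ∧
    (agreeCells n L₁ L₂ L₃).card = k ∧
    ∀ p : Fin n × Fin n, p ∉ agreeCells n L₁ L₂ L₃ →
      L₁ p.1 p.2 ≠ L₂ p.1 p.2 ∧ L₁ p.1 p.2 ≠ L₃ p.1 p.2 ∧ L₂ p.1 p.2 ≠ L₃ p.1 p.2}

/-- A pairwise balanced design `B(K, 1, v)`: blocks have sizes in `K` and every
2-element subset of the `v`-point set lies in exactly one block. -/
def IsPBD (v : ℕ) (K : Set ℕ) (A : Finset (Finset (Fin v))) : Prop :=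
  (∀ b ∈ A, b.card ∈ K) ∧
  ∀ p : Finset (Fin v), p.card = 2 → ∃! b, b ∈ A ∧ p ⊆ b

/-- Every member of `B` has three points, and any two points lie in exactly one of them. -/
def IsSteiner {α : Type*} (B : Finset (Finset α)) : Prop :=
  (∀ b ∈ B, b.card = 3) ∧ ∀ u v, u ≠ v → ∃! b, b ∈ B ∧ u ∈ b ∧ v ∈ b

theorem isSTS_iff_isSteiner {v : ℕ} {B : Finset (Finset (Fin v))} :
    IsSTS v B ↔ IsSteiner B := by
  refine and_congr_right fun _ => ⟨fun h u w huw => ?_, fun h p hp => ?_⟩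
  · simpa [Finset.insert_subset_iff] using h {u, w} (Finset.card_pair huw)
  · obtain ⟨u, w, huw, rfl⟩ := Finset.card_eq_two.1 hp
    simpa [Finset.insert_subset_iff] using h u w huw

/-- Three Steiner triple systems with pairwise intersection `I` and common flower `F` at `x`. -/
structure IsFlowerTrio {α : Type*} [DecidableEq α] (x : α) (B : Fin 3 → Finset (Finset α))
    (I F : Finset (Finset α)) : Prop where
  steiner : ∀ j, IsSteiner (B j)
  inter : ∀ j j', j ≠ j' → B j ∩ B j' = I
  flower : ∀ j, (B j).filter (x ∈ ·) = F

/-- Transport of a family of finite sets along an equivalence. -/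
def relabel {α β : Type*} (e : α ≃ β) : Finset (Finset α) ≃ Finset (Finset β) :=
  e.finsetCongr.finsetCongr

section relabel
variable {α β : Type*} (e : α ≃ β)

theorem mem_relabel {B : Finset (Finset α)} {b : Finset β} :
    b ∈ relabel e B ↔ b.map e.symm.toEmbedding ∈ B := by
  simp [relabel, Equiv.finsetCongr]

theorem card_relabel (B : Finset (Finset α)) : (relabel e B).card = B.card := by
  simp [relabel]

theorem IsSteiner.relabel {B : Finset (Finset α)} (h : IsSteiner B) :
    IsSteiner (relabel e B) := by
  refine ⟨fun b hb => ?_, fun u v huv => ?_⟩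
  · simpa using h.1 _ ((mem_relabel e).1 hb)
  · obtain ⟨b, ⟨hb, hu, hv⟩, hb'⟩ := h.2 (e.symm u) (e.symm v) (by simpa using huv)
    refine ⟨b.map e.toEmbedding, ⟨?_, ?_, ?_⟩, ?_⟩
    · rw [mem_relabel]
      simpa [Finset.map_map] using hb
    · simpa [Finset.mem_map_equiv] using hu
    · simpa [Finset.mem_map_equiv] using hv
    · rintro c ⟨hc, hcu, hcv⟩
      rw [← hb' (c.map e.symm.toEmbedding)
        ⟨(mem_relabel e).1 hc, by simpa using hcu, by simpa using hcv⟩]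
      simp [Finset.map_map]

theorem IsFlowerTrio.relabel [DecidableEq α] [DecidableEq β] {x : α}
    {B : Fin 3 → Finset (Finset α)} {I F : Finset (Finset α)} (h : IsFlowerTrio x B I F) :
    IsFlowerTrio (e x) (fun j => relabel e (B j)) (relabel e I) (relabel e F) where
  steiner j := (h.steiner j).relabel e
  inter j j' hj := by
    ext b
    simp [mem_relabel, ← h.inter j j' hj]
  flower j := by
    ext b
    simp [mem_relabel, ← h.flower j, Finset.mem_map_equiv]

end relabel

theorem IsFlowerTrio.mem_J3F {α : Type*} [Fintype α] [DecidableEq α] {r k : ℕ} {x : α}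
    {B : Fin 3 → Finset (Finset α)} {I F : Finset (Finset α)} (h : IsFlowerTrio x B I F)
    (hα : Fintype.card α = 2 * r + 1) (hI : I.card = k + r) (hF : F.card = r) :
    k ∈ J3F r := by
  have h' := h.relabel (Fintype.equivFinOfCardEq hα)
  refine ⟨_, _, _, _, isSTS_iff_isSteiner.2 (h'.steiner 0), isSTS_iff_isSteiner.2 (h'.steiner 1),
    isSTS_iff_isSteiner.2 (h'.steiner 2),
    (h'.inter 0 1 (by decide)).trans (h'.inter 0 2 (by decide)).symm,
    (h'.inter 0 1 (by decide)).trans (h'.inter 1 2 (by decide)).symm, ?_,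
    (h'.flower 0).trans (h'.flower 1).symm, (h'.flower 0).trans (h'.flower 2).symm, ?_⟩
  · rw [h'.inter 0 1 (by decide), card_relabel, hI]
  · rw [flowerAt, h'.flower 0, card_relabel, hF]

theorem exists_isFlowerTrio_of_mem_J3F {r k : ℕ} (h : k ∈ J3F r) :
    ∃ (x : Fin (2 * r + 1)) (B : Fin 3 → Finset (Finset (Fin (2 * r + 1))))
      (I F : Finset (Finset (Fin (2 * r + 1)))),
      IsFlowerTrio x B I F ∧ I.card = k + r ∧ F.card = r := by
  obtain ⟨B₁, B₂, B₃, x, s₁, s₂, s₃, h₁₃, h₂₃, hI, f₂, f₃, hF⟩ := h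
  refine ⟨x, ![B₁, B₂, B₃], _, _, ⟨?_, ?_, ?_⟩, hI, hF⟩
  · simp only [isSTS_iff_isSteiner] at s₁ s₂ s₃
    simp [Fin.forall_fin_succ, s₁, s₂, s₃]
  · simp [Fin.forall_fin_succ, ← h₁₃, ← h₂₃, Finset.inter_comm B₂ B₁, Finset.inter_comm B₃ B₁,
      Finset.inter_comm B₃ B₂]
  · simp only [flowerAt] at f₂ f₃
    simp [Fin.forall_fin_succ, flowerAt, ← f₂, ← f₃]

/-- The triple of the three points at infinity. -/
def core (β : Type*) : Finset (Fin 3 ⊕ β) := Finset.univ.map Function.Embedding.inl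

@[simp] theorem inl_mem_core {β : Type*} (c : Fin 3) : Sum.inl c ∈ core β := by simp [core]

@[simp] theorem inr_mem_core {β : Type*} (a : β) : Sum.inr a ∉ core β := by simp [core]

@[simp] theorem card_core (β : Type*) : (core β).card = 3 := by simp [core]

theorem exists_equiv_map_eq_core {n : ℕ} {α : Type*} [Fintype α] [DecidableEq α]
    (hα : Fintype.card α = n + 3) {t : Finset α} (ht : t.card = 3) {x : α} (hx : x ∈ t) :
    ∃ e : α ≃ Fin 3 ⊕ Fin n, e x = Sum.inl 0 ∧ t.map e.toEmbedding = core (Fin n) := by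
  let e₀ : {a // a ∈ t} ≃ Fin 3 := Fintype.equivFinOfCardEq (by simpa using ht)
  let e₁ := e₀.trans (Equiv.swap (e₀ ⟨x, hx⟩) 0)
  let e₂ : {a // ¬ a ∈ t} ≃ Fin n := Fintype.equivFinOfCardEq (by
    rw [Fintype.card_subtype_compl, hα]
    simp [ht])
  let e := (Equiv.sumCompl (· ∈ t)).symm.trans (Equiv.sumCongr e₁ e₂)
  have he : ∀ a (ha : a ∈ t), e a = Sum.inl (e₁ ⟨a, ha⟩) := fun a ha => by
    simp [e, Equiv.sumCompl_symm_apply_of_pos ha]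
  refine ⟨e, ?_, ?_⟩
  · rw [he x hx]
    simp [e₁]
  · refine Finset.eq_of_subset_of_card_le (fun b hb => ?_) (by simp [ht])
    obtain ⟨a, ha, rfl⟩ := Finset.mem_map.1 hb
    simp [he a ha]

/-- The data of an element of `J3F`, normalised so that the flower sits at `Sum.inl 0` and
contains the triple at infinity. -/
theorem exists_isFlowerTrio_core {r k : ℕ} (h : k ∈ J3F (r + 1)) :
    ∃ (B : Fin 3 → Finset (Finset (Fin 3 ⊕ Fin (2 * r))))
      (I F : Finset (Finset (Fin 3 ⊕ Fin (2 * r)))),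
      IsFlowerTrio (Sum.inl 0) B I F ∧ I.card = k + (r + 1) ∧ F.card = r + 1 ∧ core _ ∈ F := by
  obtain ⟨x, B, I, F, hB, hI, hF⟩ := exists_isFlowerTrio_of_mem_J3F h
  obtain ⟨t, ht⟩ : F.Nonempty := Finset.card_pos.1 (by omega)
  have ht' := ht
  rw [← hB.flower 0, Finset.mem_filter] at ht'
  obtain ⟨e, hex, het⟩ := exists_equiv_map_eq_core (n := 2 * r) (by simp; omega)
    ((hB.steiner 0).1 t ht'.1) ht'.2
  refine ⟨_, _, _, hex ▸ hB.relabel e, by rw [card_relabel, hI], by rw [card_relabel, hF], ?_⟩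
  rw [mem_relabel, ← het]
  simpa [Finset.map_map] using ht

/-- The inclusion of the `i`-th group together with the points at infinity. -/
def petal (n : ℕ) (i : Fin 3) : (Fin 3 ⊕ Fin n) ↪ (Fin 3 ⊕ Fin 3 × Fin n) :=
  (Function.Embedding.refl _).sumMap ⟨fun a => (i, a), fun _ _ h => by simpa using h⟩

/-- The triple with one point from each group. -/
def transversal (n : ℕ) (t : Fin 3 → Fin n) : Finset (Fin 3 ⊕ Fin 3 × Fin n) :=
  Finset.univ.image fun i => Sum.inr (i, t i)

/-- The triples obtained by placing `C i` on the `i`-th group and adding the transversals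
in `A`. -/
def glue {n : ℕ} (C : Fin 3 → Finset (Finset (Fin 3 ⊕ Fin n))) (A : Finset (Fin 3 → Fin n)) :
    Finset (Finset (Fin 3 ⊕ Fin 3 × Fin n)) :=
  (Finset.univ.biUnion fun i => (C i).map (Finset.mapEmbedding (petal n i)).toEmbedding) ∪
    A.image (transversal n)

section glue
variable {n : ℕ} {i : Fin 3}

@[simp] theorem petal_inl (c : Fin 3) : petal n i (Sum.inl c) = Sum.inl c := rfl

@[simp] theorem petal_inr (a : Fin n) : petal n i (Sum.inr a) = Sum.inr (i, a) := rfl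

@[simp] theorem inl_mem_map_petal {d : Finset (Fin 3 ⊕ Fin n)} {c : Fin 3} :
    Sum.inl c ∈ d.map (petal n i) ↔ Sum.inl c ∈ d := by
  simp [Finset.mem_map]

@[simp] theorem inr_mem_map_petal {d : Finset (Fin 3 ⊕ Fin n)} {p : Fin 3 × Fin n} :
    Sum.inr p ∈ d.map (petal n i) ↔ i = p.1 ∧ Sum.inr p.2 ∈ d := by
  obtain ⟨j, a⟩ := p
  simp only [Finset.mem_map, Sum.exists, petal_inl, petal_inr]
  aesop

@[simp] theorem inl_mem_transversal {t : Fin 3 → Fin n} {c : Fin 3} :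
    Sum.inl c ∉ transversal n t := by
  simp [transversal]

@[simp] theorem inr_mem_transversal {t : Fin 3 → Fin n} {p : Fin 3 × Fin n} :
    Sum.inr p ∈ transversal n t ↔ t p.1 = p.2 := by
  obtain ⟨j, a⟩ := p
  simp [transversal]

theorem transversal_injective : Function.Injective (transversal n) := fun t s h =>
  funext fun i => by
    have : Sum.inr (i, s i) ∈ transversal n t := h ▸ by simp
    simpa using this

theorem card_transversal (t : Fin 3 → Fin n) : (transversal n t).card = 3 := by
  rw [transversal, Finset.card_image_of_injective _ fun i j h =>
    (Prod.ext_iff.1 (Sum.inr_injective h)).1]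
  simp

theorem map_petal_ne_transversal (d : Finset (Fin 3 ⊕ Fin n)) (t : Fin 3 → Fin n) :
    d.map (petal n i) ≠ transversal n t := fun h => by
  have : Sum.inr (i + 1, t (i + 1)) ∈ d.map (petal n i) := h ▸ by simp
  simp at this

theorem map_core_petal : (core (Fin n)).map (petal n i) = core _ := by
  ext (c | p) <;> simp

theorem eq_core_of_map_petal_eq {j : Fin 3} (hij : i ≠ j) {d d' : Finset (Fin 3 ⊕ Fin n)}
    (hd : d.card = 3) (h : d.map (petal n i) = d'.map (petal n j)) : d = core _ := by
  refine Finset.eq_of_subset_of_card_le (fun p hp => ?_) (by simp [hd])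
  obtain c | a := p
  · simp
  · have : Sum.inr (i, a) ∈ d'.map (petal n j) := h ▸ by simpa using hp
    exact absurd (inr_mem_map_petal.1 this).1.symm hij

theorem mem_glue {C : Fin 3 → Finset (Finset (Fin 3 ⊕ Fin n))} {A : Finset (Fin 3 → Fin n)}
    {b : Finset (Fin 3 ⊕ Fin 3 × Fin n)} :
    b ∈ glue C A ↔ (∃ i, ∃ d ∈ C i, d.map (petal n i) = b) ∨ ∃ t ∈ A, transversal n t = b := by
  simp [glue]

theorem glue_inter {C C' : Fin 3 → Finset (Finset (Fin 3 ⊕ Fin n))}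
    {A A' : Finset (Fin 3 → Fin n)} (hC : ∀ i, ∀ d ∈ C i, d.card = 3)
    (h : ∀ i, core _ ∈ C' i) :
    glue C A ∩ glue C' A' = glue (fun i => C i ∩ C' i) (A ∩ A') := by
  ext b
  simp only [Finset.mem_inter, mem_glue]
  constructor
  · rintro ⟨⟨i, d, hd, rfl⟩ | ⟨t, ht, rfl⟩, ⟨j, d', hd', hb⟩ | ⟨t', ht', hb⟩⟩
    · refine Or.inl ⟨i, d, ⟨hd, ?_⟩, rfl⟩
      by_cases hij : i = j
      · subst hij
        rwa [← Finset.map_injective _ hb]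
      · rw [eq_core_of_map_petal_eq hij (hC i d hd) hb.symm]
        exact h i
    · exact absurd hb.symm (map_petal_ne_transversal _ _)
    · exact absurd hb (map_petal_ne_transversal _ _)
    · exact Or.inr ⟨t, ⟨ht, transversal_injective hb ▸ ht'⟩, rfl⟩
  · rintro (⟨i, d, ⟨hd, hd'⟩, rfl⟩ | ⟨t, ⟨ht, ht'⟩, rfl⟩)
    · exact ⟨Or.inl ⟨i, d, hd, rfl⟩, Or.inl ⟨i, d, hd', rfl⟩⟩
    · exact ⟨Or.inr ⟨t, ht, rfl⟩, Or.inr ⟨t, ht', rfl⟩⟩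

theorem filter_inl_mem_glue (C : Fin 3 → Finset (Finset (Fin 3 ⊕ Fin n)))
    (A : Finset (Fin 3 → Fin n)) (c : Fin 3) :
    (glue C A).filter (Sum.inl c ∈ ·) = glue (fun i => (C i).filter (Sum.inl c ∈ ·)) ∅ := by
  ext b
  simp only [Finset.mem_filter, mem_glue]
  constructor
  · rintro ⟨⟨i, d, hd, rfl⟩ | ⟨t, ht, rfl⟩, hb⟩
    · exact Or.inl ⟨i, d, ⟨hd, by simpa using hb⟩, rfl⟩
    · simp at hb
  · rintro (⟨i, d, ⟨hd, hc⟩, rfl⟩ | ⟨t, ht, rfl⟩)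
    · exact ⟨Or.inl ⟨i, d, hd, rfl⟩, by simpa using hc⟩
    · simp at ht

theorem card_glue {C : Fin 3 → Finset (Finset (Fin 3 ⊕ Fin n))} {A : Finset (Fin 3 → Fin n)}
    (hC : ∀ i, ∀ d ∈ C i, d.card = 3) (h : ∀ i, core _ ∈ C i) :
    (glue C A).card + 2 = ∑ i, (C i).card + A.card := by
  have hglue : glue C A = insert (core _) (Finset.univ.biUnion fun i =>
      ((C i).erase (core _)).map (Finset.mapEmbedding (petal n i)).toEmbedding) ∪
        A.image (transversal n) := by
    ext b
    simp only [mem_glue, Finset.mem_union, Finset.mem_insert, Finset.mem_biUnion, Finset.mem_map,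
      Finset.mem_image, Finset.mem_erase, Finset.mem_univ, true_and]
    refine or_congr_left ⟨?_, ?_⟩
    · rintro ⟨i, d, hd, rfl⟩
      by_cases hdc : d = core _
      · exact Or.inl (hdc ▸ map_core_petal)
      · exact Or.inr ⟨i, d, ⟨hdc, hd⟩, rfl⟩
    · rintro (rfl | ⟨i, d, ⟨-, hd⟩, rfl⟩)
      · exact ⟨0, _, h 0, map_core_petal⟩
      · exact ⟨i, d, hd, rfl⟩
  have hi : ∀ i, ((C i).erase (core _)).card + 1 = (C i).card := fun i =>
    Finset.card_erase_add_one (h i)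
  rw [hglue, Finset.card_union_of_disjoint, Finset.card_insert_of_notMem, Finset.card_biUnion,
    Finset.card_image_of_injective _ transversal_injective]
  · simp only [Finset.card_map, Fin.sum_univ_three, ← hi]
    omega
  · intro i _ j _ hij
    refine Finset.disjoint_left.2 fun b hb hb' => ?_
    obtain ⟨d, hd, rfl⟩ := Finset.mem_map.1 hb
    obtain ⟨d', hd', hdd⟩ := Finset.mem_map.1 hb'
    rw [Finset.mem_erase] at hd
    exact hd.1 (eq_core_of_map_petal_eq hij (hC i d hd.2) hdd.symm)
  · simp only [Finset.mem_biUnion, Finset.mem_map, Finset.mem_erase, not_exists, not_and]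
    rintro i - d ⟨hd, -⟩ hdc
    exact hd (Finset.map_injective (petal n i) (hdc.trans map_core_petal.symm))
  · refine Finset.disjoint_left.2 fun b hb hb' => ?_
    obtain ⟨t, -, rfl⟩ := Finset.mem_image.1 hb'
    simp only [Finset.mem_insert, Finset.mem_biUnion, Finset.mem_map] at hb
    obtain hb | ⟨i, -, d, -, hd⟩ := hb
    · exact map_petal_ne_transversal (i := 0) _ _ (map_core_petal.trans hb.symm)
    · exact map_petal_ne_transversal _ _ hd

theorem isSteiner_glue {C : Fin 3 → Finset (Finset (Fin 3 ⊕ Fin n))}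
    {A : Finset (Fin 3 → Fin n)} (hC : ∀ i, IsSteiner (C i)) (h : ∀ i, core _ ∈ C i)
    (hA : ∀ i j, i ≠ j → ∀ a b, ∃! t, t ∈ A ∧ t i = a ∧ t j = b) : IsSteiner (glue C A) := by
  have key : ∀ i u v, u ≠ v → (∃ a, v = Sum.inr a) →
      ∃! b, b ∈ glue C A ∧ petal n i u ∈ b ∧ petal n i v ∈ b := by
    rintro i u _ huv ⟨a, rfl⟩
    obtain ⟨d, ⟨hd, hu, hv⟩, hd'⟩ := (hC i).2 u _ huv
    refine ⟨d.map (petal n i), ⟨mem_glue.2 (Or.inl ⟨i, d, hd, rfl⟩), by simpa using hu,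
      by simpa using hv⟩, ?_⟩
    rintro b ⟨hb, hbu, hbv⟩
    obtain ⟨j, d', hj, rfl⟩ | ⟨t, ht, rfl⟩ := mem_glue.1 hb
    · obtain rfl : j = i := (inr_mem_map_petal.1 hbv).1
      rw [hd' d' ⟨hj, by simpa using hbu, by simpa using hbv⟩]
    · obtain c | a' := u
      · simp at hbu
      · simp only [petal_inr, inr_mem_transversal] at hbu hbv
        exact absurd (congrArg Sum.inr (hbu.symm.trans hbv)) huv
  refine ⟨fun b hb => ?_, ?_⟩
  · obtain ⟨i, d, hd, rfl⟩ | ⟨t, -, rfl⟩ := mem_glue.1 hb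
    · simpa using (hC i).1 d hd
    · exact card_transversal t
  rintro (c | ⟨i, a⟩) (c' | ⟨j, a'⟩) huv
  · refine ⟨core _, ⟨mem_glue.2 (Or.inl ⟨0, _, h 0, map_core_petal⟩), by simp, by simp⟩, ?_⟩
    rintro b ⟨hb, hbu, hbv⟩
    obtain ⟨j, d, hd, rfl⟩ | ⟨t, -, rfl⟩ := mem_glue.1 hb
    · rw [((hC j).2 (Sum.inl c) (Sum.inl c') (by simpa using huv)).unique
        ⟨hd, by simpa using hbu, by simpa using hbv⟩ ⟨h j, by simp, by simp⟩, map_core_petal]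
    · simp at hbu
  · exact key j (Sum.inl c) (Sum.inr a') (by simp) ⟨_, rfl⟩
  · simpa only [and_comm, petal_inl, petal_inr] using
      key i (Sum.inl c') (Sum.inr a) (by simp) ⟨_, rfl⟩
  · by_cases hij : i = j
    · subst hij
      exact key i (Sum.inr a) (Sum.inr a') (by simpa using huv) ⟨_, rfl⟩
    · obtain ⟨t, ⟨ht, hi, hj⟩, ht'⟩ := hA i j hij a a'
      refine ⟨transversal n t, ⟨mem_glue.2 (Or.inr ⟨t, ht, rfl⟩), by simpa, by simpa⟩, ?_⟩
      rintro b ⟨hb, hbu, hbv⟩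
      obtain ⟨k, d, hd, rfl⟩ | ⟨s, hs, rfl⟩ := mem_glue.1 hb
      · simp only [inr_mem_map_petal] at hbu hbv
        exact absurd (hbu.1.symm.trans hbv.1) hij
      · rw [ht' s ⟨hs, by simpa using hbu, by simpa using hbv⟩]

end glue

/-- The triples (row, column, symbol) of the cells of `L` lying in `S`. -/
def cellTriples {n : ℕ} (L : Fin n → Fin n → Fin n) (S : Finset (Fin n × Fin n)) :
    Finset (Fin 3 → Fin n) :=
  S.image fun p => ![p.1, p.2, L p.1 p.2]

theorem mem_cellTriples {n : ℕ} {L : Fin n → Fin n → Fin n} {S : Finset (Fin n × Fin n)}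
    {t : Fin 3 → Fin n} : t ∈ cellTriples L S ↔ (t 0, t 1) ∈ S ∧ L (t 0) (t 1) = t 2 := by
  simp only [cellTriples, Finset.mem_image]
  constructor
  · rintro ⟨p, hp, rfl⟩
    simpa using hp
  · rintro ⟨h, h'⟩
    refine ⟨_, h, funext fun i => ?_⟩
    fin_cases i <;> simp [h']

theorem card_cellTriples {n : ℕ} (L : Fin n → Fin n → Fin n) (S : Finset (Fin n × Fin n)) :
    (cellTriples L S).card = S.card :=
  Finset.card_image_of_injective _ fun p q h =>
    Prod.ext (by simpa using congrFun h 0) (by simpa using congrFun h 1)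

theorem IsLatin.existsUnique_cellTriples {n : ℕ} {L : Fin n → Fin n → Fin n} (h : IsLatin n L)
    (i j : Fin 3) (hij : i ≠ j) (a b : Fin n) :
    ∃! t, t ∈ cellTriples L Finset.univ ∧ t i = a ∧ t j = b := by
  have hrow := h.1
  have hcol := h.2
  have h01 : ∀ a b, ∃! t, t ∈ cellTriples L Finset.univ ∧ t 0 = a ∧ t 1 = b := fun a b => by
    refine ⟨![a, b, L a b], by simp [mem_cellTriples], ?_⟩
    rintro t ⟨ht, rfl, rfl⟩
    funext i
    fin_cases i <;> simp [(mem_cellTriples.1 ht).2]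
  have h02 : ∀ a b, ∃! t, t ∈ cellTriples L Finset.univ ∧ t 0 = a ∧ t 2 = b := fun a b => by
    obtain ⟨c, rfl⟩ := Finite.surjective_of_injective (hrow a) b
    refine ⟨![a, c, L a c], by simp [mem_cellTriples], ?_⟩
    rintro t ⟨ht, rfl, h2⟩
    have h1 : t 1 = c := hrow _ ((mem_cellTriples.1 ht).2.trans h2)
    funext i
    fin_cases i <;> simp [h1, h2]
  have h12 : ∀ a b, ∃! t, t ∈ cellTriples L Finset.univ ∧ t 1 = a ∧ t 2 = b := fun a b => by
    obtain ⟨c, rfl⟩ := Finite.surjective_of_injective (hcol a) b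
    refine ⟨![c, a, L c a], by simp [mem_cellTriples], ?_⟩
    rintro t ⟨ht, rfl, h2⟩
    have h1 : t 0 = c := hcol _ ((mem_cellTriples.1 ht).2.trans h2)
    funext i
    fin_cases i <;> simp [h1, h2]
  have hswap : ∀ {i j}, (∀ a b, ∃! t, t ∈ cellTriples L Finset.univ ∧ t i = a ∧ t j = b) →
      ∀ a b, ∃! t, t ∈ cellTriples L Finset.univ ∧ t j = a ∧ t i = b := fun h a b => by
    simpa only [and_comm] using h b a
  fin_cases i <;> fin_cases j
  · exact absurd rfl hij
  · exact h01 a b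
  · exact h02 a b
  · exact hswap h01 a b
  · exact absurd rfl hij
  · exact h12 a b
  · exact hswap h02 a b
  · exact hswap h12 a b
  · exact absurd rfl hij

theorem exists_latin_of_mem_J3L {n k : ℕ} (h : k ∈ J3L n) :
    ∃ (A : Fin 3 → Finset (Fin 3 → Fin n)) (D : Finset (Fin 3 → Fin n)), D.card = k ∧
      (∀ j j', j ≠ j' → A j ∩ A j' = D) ∧
      ∀ l i j, i ≠ j → ∀ a b, ∃! t, t ∈ A l ∧ t i = a ∧ t j = b := by
  obtain ⟨L₁, L₂, L₃, h₁, h₂, h₃, hk, hne⟩ := h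
  have e₁₂ : cellTriples L₁ Finset.univ ∩ cellTriples L₂ Finset.univ =
      cellTriples L₁ (agreeCells n L₁ L₂ L₃) := by
    ext t
    have := hne (t 0, t 1)
    simp only [Finset.mem_inter, mem_cellTriples, agreeCells, Finset.mem_filter, Finset.mem_univ,
      true_and] at this ⊢
    grind
  have e₁₃ : cellTriples L₁ Finset.univ ∩ cellTriples L₃ Finset.univ =
      cellTriples L₁ (agreeCells n L₁ L₂ L₃) := by
    ext t
    have := hne (t 0, t 1)
    simp only [Finset.mem_inter, mem_cellTriples, agreeCells, Finset.mem_filter, Finset.mem_univ,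
      true_and] at this ⊢
    grind
  have e₂₃ : cellTriples L₂ Finset.univ ∩ cellTriples L₃ Finset.univ =
      cellTriples L₁ (agreeCells n L₁ L₂ L₃) := by
    ext t
    have := hne (t 0, t 1)
    simp only [Finset.mem_inter, mem_cellTriples, agreeCells, Finset.mem_filter, Finset.mem_univ,
      true_and] at this ⊢
    grind
  refine ⟨fun l => cellTriples (![L₁, L₂, L₃] l) Finset.univ,
    cellTriples L₁ (agreeCells n L₁ L₂ L₃), by rw [card_cellTriples, hk], ?_, fun l => ?_⟩
  · intro j j' hj
    fin_cases j <;> fin_cases j'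
    · exact absurd rfl hj
    · exact e₁₂
    · exact e₁₃
    · exact (Finset.inter_comm _ _).trans e₁₂
    · exact absurd rfl hj
    · exact e₂₃
    · exact (Finset.inter_comm _ _).trans e₁₃
    · exact (Finset.inter_comm _ _).trans e₂₃
    · exact absurd rfl hj
  · refine IsLatin.existsUnique_cellTriples ?_
    fin_cases l
    exacts [h₁, h₂, h₃]

theorem isFlowerTrio_glue {n : ℕ} {B : Fin 3 → Fin 3 → Finset (Finset (Fin 3 ⊕ Fin n))}
    {I F : Fin 3 → Finset (Finset (Fin 3 ⊕ Fin n))} {A : Fin 3 → Finset (Fin 3 → Fin n)}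
    {D : Finset (Fin 3 → Fin n)} (hB : ∀ i, IsFlowerTrio (Sum.inl 0) (B i) (I i) (F i))
    (hF : ∀ i, core _ ∈ F i) (hD : ∀ j j', j ≠ j' → A j ∩ A j' = D)
    (hA : ∀ l i j, i ≠ j → ∀ a b, ∃! t, t ∈ A l ∧ t i = a ∧ t j = b) :
    IsFlowerTrio (Sum.inl 0) (fun j => glue (fun i => B i j) (A j)) (glue I D) (glue F ∅) := by
  have hcore : ∀ i j, core _ ∈ B i j := fun i j =>
    (Finset.mem_filter.1 ((hB i).flower j ▸ hF i)).1
  refine ⟨fun j => isSteiner_glue (fun i => (hB i).steiner j) (fun i => hcore i j) (hA j),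
    fun j j' hj => ?_, fun j => ?_⟩
  · rw [glue_inter (fun i => ((hB i).steiner j).1)
      fun i => hcore i j', hD j j' hj]
    simp only [(hB _).inter j j' hj]
  · simp only [filter_inl_mem_glue, (hB _).flower j]

/-- For every `r ≡ 0, 2 (mod 3)`, if `b ∈ J'³(2r)` and
`a₁, a₂, a₃ ∈ J³_F(r+1)`, then `a₁ + a₂ + a₃ + b ∈ J³_F(3r+1)`. -/
theorem stmt5 (r : ℕ) (hr : r % 3 = 0 ∨ r % 3 = 2) (b a₁ a₂ a₃ : ℕ)
    (hb : b ∈ J3L (2 * r))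
    (h₁ : a₁ ∈ J3F (r + 1)) (h₂ : a₂ ∈ J3F (r + 1)) (h₃ : a₃ ∈ J3F (r + 1)) :
    a₁ + a₂ + a₃ + b ∈ J3F (3 * r + 1) := by
  obtain ⟨A, D, hDb, hD, hA⟩ := exists_latin_of_mem_J3L hb
  have h : ∀ i, ![a₁, a₂, a₃] i ∈ J3F (r + 1) := by simp [Fin.forall_fin_succ, h₁, h₂, h₃]
  choose B I F hB hI hF hcF using fun i => exists_isFlowerTrio_core (h i)
  have hF₀ : ∀ i, F i ⊆ B i 0 := fun i => (hB i).flower 0 ▸ Finset.filter_subset _ _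
  have hI₀ : ∀ i, I i ⊆ B i 0 := fun i =>
    (hB i).inter 0 1 (by decide) ▸ Finset.inter_subset_left
  have hFI : ∀ i, F i ⊆ I i := fun i d hd => by
    rw [← (hB i).inter 0 1 (by decide), Finset.mem_inter]
    exact ⟨hF₀ i hd, (Finset.mem_filter.1 ((hB i).flower 1 ▸ hd)).1⟩
  have hcI := card_glue (A := D) (fun i d hd => ((hB i).steiner 0).1 d (hI₀ i hd))
    fun i => hFI i (hcF i)
  have hcF' := card_glue (A := ∅) (fun i d hd => ((hB i).steiner 0).1 d (hF₀ i hd)) hcF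
  simp only [Fin.sum_univ_three, hI, hDb, Matrix.cons_val] at hcI
  simp only [hF, Finset.sum_const, Finset.card_univ, Fintype.card_fin, smul_eq_mul,
    Finset.card_empty] at hcF'
  refine (isFlowerTrio_glue hB hcF hD hA).mem_J3F ?_ ?_ ?_
  · simp
    ring
  · omega
  · omega
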